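/- Let ε > 0, L > 0, and let f : ℝ × ℝ² → ℝ be three times continuously differentiable with all partial derivatives up to order 3 bounded on ℝ × [0,L]², satisfying ∂_t f + (y/ε) ∂_x f − (x/ε) ∂_y f = 0 everywhere. For Δt, Δx, Δy > 0 define the IMP truncation error at points with x ≥ 0, y ≥ 0: T(Δt,Δx,Δy)(t,x,y) := (f(t+Δt,x,y) − f(t,x,y))/Δt + (y/ε)(f(t+Δt,x,y) − f(t+Δt,x−Δx,y))/Δx − (x/ε)(f(t+Δt,x,y+Δy) − f(t+Δt,x,y))/Δy. Then there exists C > 0 such that for all Δt, Δx, Δy ∈ (0,1] and all (t,x,y) ∈ ℝ × [0,L]²: | T(Δt,Δx,Δy)(t,x,y) − (Δt/(2ε²)) ( y ∂_y f + x ∂_x f + 2 x y ∂²_{xy} f )(t,x,y) + (y Δx/(2ε)) (1 + y Δt/(ε Δx)) ∂²_{xx} f(t,x,y) + (x Δy/(2ε)) (1 + x Δt/(ε Δy)) ∂²_{yy} f(t,x,y) | ≤ C (Δt² + Δx² + Δy²). In particular the fully implicit IMP upwind scheme is consistent with the equation and first order accurate in time and space, with a numerical diffusion proportional to 1/ε in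 all directions. -/

import Mathlib

/-- The directional derivative of `g` along the constant vector field `v`. -/
noncomputable def dirDeriv {E : Type*} [NormedAddCommGroup E] [NormedSpace ℝ E]
    (v : E) (g : E → ℝ) (p : E) : ℝ :=
  fderiv ℝ g p v

section DirDeriv

variable {E : Type*} [NormedAddCommGroup E] [NormedSpace ℝ E]

theorem ContDiff.dirDeriv {g : E → ℝ} {m n : WithTop ℕ∞} (hg : ContDiff ℝ n g)
    (hmn : m + 1 ≤ n) (v : E) : ContDiff ℝ m (dirDeriv v g) :=
  (hg.fderiv_right hmn).clm_apply contDiff_const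

theorem dirDeriv_comm {g : E → ℝ} (hg : ContDiff ℝ 2 g) (v w : E) :
    dirDeriv v (dirDeriv w g) = dirDeriv w (dirDeriv v g) := by
  have hd : Differentiable ℝ (fderiv ℝ g) :=
    (hg.fderiv_right (m := 1) (by norm_num)).differentiable (by norm_num)
  have key : ∀ (a b p : E), dirDeriv a (dirDeriv b g) p = fderiv ℝ (fderiv ℝ g) p a b := by
    intro a b p
    have h := (hd p).hasFDerivAt.clm_apply (hasFDerivAt_const b p)
    have h' : fderiv ℝ (dirDeriv b g) p = _ := h.fderiv
    rw [dirDeriv, h']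
    simp
  ext p
  rw [key, key]
  exact (hg.contDiffAt.isSymmSndFDerivAt (by simp)).eq v w

theorem hasDerivAt_comp_dirDeriv {g : E → ℝ} (hg : ContDiff ℝ 1 g) {c : ℝ → E} {v : E} {s : ℝ}
    (hc : HasDerivAt c v s) : HasDerivAt (fun u => g (c u)) (dirDeriv v g (c s)) s :=
  ((hg.differentiable (by norm_num)) (c s)).hasFDerivAt.comp_hasDerivAt s hc

theorem dirDeriv_periodic {g : E → ℝ} {c : E} (hg : Function.Periodic g c) (v : E) :
    Function.Periodic (dirDeriv v g) c := by
  intro p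
  have h : (fun q => g (q + c)) = g := funext hg
  rw [dirDeriv, ← fderiv_comp_add_right, h, dirDeriv]

end DirDeriv

theorem abs_sub_le_of_hasDerivAt_uIcc {g g' : ℝ → ℝ} (hg : ∀ u, HasDerivAt g (g' u) u)
    {M a b : ℝ} (hM : ∀ u ∈ Set.uIcc a b, |g' u| ≤ M) :
    ∀ u ∈ Set.uIcc a b, |g u - g a| ≤ M * |b - a| := by
  intro u hu
  have h := (convex_uIcc a b).norm_image_sub_le_of_norm_hasDerivWithin_le
    (fun z _ => (hg z).hasDerivWithinAt) hM Set.left_mem_uIcc hu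
  have hM0 : 0 ≤ M := (abs_nonneg _).trans (hM a Set.left_mem_uIcc)
  exact h.trans (mul_le_mul_of_nonneg_left (Set.abs_sub_left_of_mem_uIcc hu) hM0)

theorem abs_slope_sub_taylor_le {g g₁ g₂ g₃ : ℝ → ℝ} (h₁ : ∀ u, HasDerivAt g (g₁ u) u)
    (h₂ : ∀ u, HasDerivAt g₁ (g₂ u) u) (h₃ : ∀ u, HasDerivAt g₂ (g₃ u) u)
    {M a b : ℝ} (hab : a ≠ b) (hM : ∀ u ∈ Set.uIcc a b, |g₃ u| ≤ M) :
    |(g b - g a) / (b - a) - g₁ a - (b - a) / 2 * g₂ a| ≤ M * (b - a) ^ 2 := by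
  have e₂ := abs_sub_le_of_hasDerivAt_uIcc h₃ hM
  have d₁ : ∀ u, HasDerivAt (fun u => g₁ u - (u - a) * g₂ a) (g₂ u - g₂ a) u := fun u => by
    refine ((h₂ u).sub (((hasDerivAt_id u).sub_const a).mul_const (g₂ a))).congr_deriv ?_
    ring
  have e₁ := abs_sub_le_of_hasDerivAt_uIcc d₁ e₂
  have d₀ : ∀ u, HasDerivAt (fun u => g u - u * g₁ a - (u - a) ^ 2 / 2 * g₂ a)
      (g₁ u - (u - a) * g₂ a - (g₁ a - (a - a) * g₂ a)) u := fun u => by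
    refine (((h₁ u).sub ((hasDerivAt_id u).mul_const (g₁ a))).sub
      (((((hasDerivAt_id u).sub_const a).pow 2).div_const 2).mul_const (g₂ a))).congr_deriv ?_
    simp
    ring
  have e₀ := abs_sub_le_of_hasDerivAt_uIcc d₀ e₁ b Set.right_mem_uIcc
  have hne : b - a ≠ 0 := sub_ne_zero.mpr hab.symm
  have hpos : 0 < |b - a| := abs_pos.mpr hne
  refine le_of_mul_le_mul_right ?_ hpos
  rw [← abs_mul, ← sq_abs (b - a)]
  refine le_trans (le_of_eq ?_) (e₀.trans (le_of_eq ?_))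
  · congr 1
    field_simp
    ring
  · ring

/-- A continuous function that is periodic in its first variable is bounded on strips
over compact sets. -/
theorem exists_abs_le_of_periodic_fst {F : ℝ × ℝ × ℝ → ℝ} (hF : Continuous F) {T : ℝ}
    (hT : 0 < T) (hper : Function.Periodic F (T, 0, 0)) (a b : ℝ) :
    ∃ M, ∀ t, ∀ x ∈ Set.Icc a b, ∀ y ∈ Set.Icc a b, |F (t, x, y)| ≤ M := by
  obtain ⟨M, hM⟩ := (isCompact_Icc.prod (isCompact_Icc.prod isCompact_Icc) :
    IsCompact (Set.Icc 0 T ×ˢ Set.Icc a b ×ˢ Set.Icc a b)).exists_bound_of_continuousOn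
      hF.continuousOn
  refine ⟨M, fun t x hx y hy => ?_⟩
  have hp : Function.Periodic (fun s => F (s, x, y)) T := fun s => by
    simpa using hper (s, x, y)
  obtain ⟨s, hs, hts⟩ := hp.exists_mem_Ico₀ hT t
  rw [hts]
  exact hM (s, x, y) ⟨Set.Ico_subset_Icc_self hs, hx, hy⟩

theorem hasDerivAt_slice₁ (t x y : ℝ) : HasDerivAt (fun s : ℝ => (s, x, y)) (1, 0, 0) t :=
  (hasDerivAt_id t).prodMk (hasDerivAt_const t (x, y))

theorem hasDerivAt_slice₂ (t x y : ℝ) : HasDerivAt (fun u : ℝ => (t, u, y)) (0, 1, 0) x :=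
  (hasDerivAt_const x t).prodMk ((hasDerivAt_id x).prodMk (hasDerivAt_const x y))

theorem hasDerivAt_slice₃ (t x y : ℝ) : HasDerivAt (fun v : ℝ => (t, x, v)) (0, 0, 1) y :=
  (hasDerivAt_const y t).prodMk ((hasDerivAt_const y x).prodMk (hasDerivAt_id y))

/-- The characteristics of the rotation equation are `2πε`-periodic, hence so are its
solutions. -/
theorem periodic_of_rotation_transport {ε : ℝ} (hε : ε ≠ 0) {f : ℝ × ℝ × ℝ → ℝ}
    (hf : ContDiff ℝ 1 f)
    (hpde : ∀ t x y : ℝ, dirDeriv (1, 0, 0) f (t, x, y) + y / ε * dirDeriv (0, 1, 0) f (t, x, y)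
      - x / ε * dirDeriv (0, 0, 1) f (t, x, y) = 0) :
    Function.Periodic f (2 * Real.pi * ε, 0, 0) := by
  rintro ⟨t, x, y⟩
  let X : ℝ → ℝ := fun s => x * Real.cos (s / ε) + y * Real.sin (s / ε)
  let Y : ℝ → ℝ := fun s => y * Real.cos (s / ε) - x * Real.sin (s / ε)
  have hdiv : ∀ s, HasDerivAt (fun s : ℝ => s / ε) (1 / ε) s := fun s =>
    (hasDerivAt_id s).div_const ε
  have hX : ∀ s, HasDerivAt X (Y s / ε) s := fun s => by
    refine (((hdiv s).cos.const_mul x).add ((hdiv s).sin.const_mul y)).congr_deriv ?_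
    simp only [Y]
    ring
  have hY : ∀ s, HasDerivAt Y (-(X s / ε)) s := fun s => by
    refine (((hdiv s).cos.const_mul y).sub ((hdiv s).sin.const_mul x)).congr_deriv ?_
    simp only [X]
    ring
  have hh : ∀ s, HasDerivAt (fun s => f (t + s, X s, Y s)) 0 s := fun s => by
    have hc : HasDerivAt (fun s => (t + s, X s, Y s)) ((1 : ℝ), Y s / ε, -(X s / ε)) s :=
      ((hasDerivAt_id s).const_add t).prodMk ((hX s).prodMk (hY s))
    refine (hasDerivAt_comp_dirDeriv hf hc).congr_deriv ?_
    have hv : ((1 : ℝ), Y s / ε, -(X s / ε)) = ((1 : ℝ), (0 : ℝ), (0 : ℝ))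
        + (Y s / ε) • ((0 : ℝ), (1 : ℝ), (0 : ℝ)) - (X s / ε) • ((0 : ℝ), (0 : ℝ), (1 : ℝ)) := by
      ext <;> simp
    rw [← hpde (t + s) (X s) (Y s), hv]
    simp only [dirDeriv, map_add, map_sub, map_smul, smul_eq_mul]
  have hconst := is_const_of_deriv_eq_zero (fun s => (hh s).differentiableAt)
    (fun s => (hh s).deriv) (2 * Real.pi * ε) 0
  have hq : 2 * Real.pi * ε / ε = 2 * Real.pi := by field_simp
  simpa [X, Y, hq] using hconst

/-- The second time derivative of a solution of the rotation equation, in terms of its space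
derivatives. -/
theorem rotation_transport_second_time_deriv {ε : ℝ} (hε : ε ≠ 0) {f : ℝ × ℝ × ℝ → ℝ}
    (hf : ContDiff ℝ 2 f)
    (hpde : ∀ t x y : ℝ, dirDeriv (1, 0, 0) f (t, x, y) + y / ε * dirDeriv (0, 1, 0) f (t, x, y)
      - x / ε * dirDeriv (0, 0, 1) f (t, x, y) = 0) (t x y : ℝ) :
    ε ^ 2 * dirDeriv (1, 0, 0) (dirDeriv (1, 0, 0) f) (t, x, y)
      = y ^ 2 * dirDeriv (0, 1, 0) (dirDeriv (0, 1, 0) f) (t, x, y)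
        + x ^ 2 * dirDeriv (0, 0, 1) (dirDeriv (0, 0, 1) f) (t, x, y)
        - y * dirDeriv (0, 0, 1) f (t, x, y) - x * dirDeriv (0, 1, 0) f (t, x, y)
        - 2 * x * y * dirDeriv (0, 1, 0) (dirDeriv (0, 0, 1) f) (t, x, y) := by
  have hD : ∀ v, ContDiff ℝ 1 (dirDeriv v f) := fun v => hf.dirDeriv (by norm_num) v
  have ht := (((hasDerivAt_comp_dirDeriv (hD (1, 0, 0)) (hasDerivAt_slice₁ t x y)).add
    ((hasDerivAt_comp_dirDeriv (hD (0, 1, 0)) (hasDerivAt_slice₁ t x y)).const_mul (y / ε))).sub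
    ((hasDerivAt_comp_dirDeriv (hD (0, 0, 1)) (hasDerivAt_slice₁ t x y)).const_mul
      (x / ε))).unique
    ((hasDerivAt_const t (0 : ℝ)).congr_of_eventuallyEq (.of_forall fun s => hpde s x y))
  have hx := (((hasDerivAt_comp_dirDeriv (hD (1, 0, 0)) (hasDerivAt_slice₂ t x y)).add
    ((hasDerivAt_comp_dirDeriv (hD (0, 1, 0)) (hasDerivAt_slice₂ t x y)).const_mul (y / ε))).sub
    (((hasDerivAt_id x).div_const ε).mul
      (hasDerivAt_comp_dirDeriv (hD (0, 0, 1)) (hasDerivAt_slice₂ t x y)))).unique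
    ((hasDerivAt_const x (0 : ℝ)).congr_of_eventuallyEq (.of_forall fun u => hpde t u y))
  have hy := (((hasDerivAt_comp_dirDeriv (hD (1, 0, 0)) (hasDerivAt_slice₃ t x y)).add
    (((hasDerivAt_id y).div_const ε).mul
      (hasDerivAt_comp_dirDeriv (hD (0, 1, 0)) (hasDerivAt_slice₃ t x y)))).sub
    ((hasDerivAt_comp_dirDeriv (hD (0, 0, 1)) (hasDerivAt_slice₃ t x y)).const_mul
      (x / ε))).unique
    ((hasDerivAt_const y (0 : ℝ)).congr_of_eventuallyEq (.of_forall fun v => hpde t x v))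
  rw [dirDeriv_comm hf (1, 0, 0) (0, 1, 0), dirDeriv_comm hf (1, 0, 0) (0, 0, 1)] at ht
  rw [dirDeriv_comm hf (0, 0, 1) (0, 1, 0)] at hy
  simp only [id] at hx hy
  field_simp at ht hx hy
  linear_combination ε * ht - y * hx + x * hy


/-- Assembly of the truncation error estimate from one-dimensional Taylor estimates at the new
time level (`g`-quantities) and the time increments of second derivatives. -/
theorem imp_truncation_error_le {ε L M Δt Δx Δy x y F₀ F₁ F₂ F₃ fx fy fxx fyy fxy ftt
    gt gx gy gtt gxx gyy : ℝ} (hε : 0 < ε) (hL : 0 < L) (hM0 : 0 ≤ M)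
    (ht0 : 0 < Δt) (hx0 : 0 < Δx) (hy0 : 0 < Δy)
    (hxl : 0 ≤ x) (hxu : x ≤ L) (hyl : 0 ≤ y) (hyu : y ≤ L)
    (Tt : |(F₀ - F₁) / -Δt - gt - -Δt / 2 * gtt| ≤ M * Δt ^ 2)
    (Tx : |(F₂ - F₁) / -Δx - gx - -Δx / 2 * gxx| ≤ M * Δx ^ 2)
    (Ty : |(F₃ - F₁) / Δy - gy - Δy / 2 * gyy| ≤ M * Δy ^ 2)
    (Stt : |gtt - ftt| ≤ M * Δt) (Sxx : |gxx - fxx| ≤ M * Δt) (Syy : |gyy - fyy| ≤ M * Δt)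
    (hs : gt + y / ε * gx - x / ε * gy = 0)
    (htt : ε ^ 2 * ftt = y ^ 2 * fxx + x ^ 2 * fyy - y * fy - x * fx - 2 * x * y * fxy) :
    |((F₁ - F₀) / Δt + (y / ε) * (F₁ - F₂) / Δx - (x / ε) * (F₃ - F₁) / Δy)
        - (Δt / (2 * ε ^ 2)) * (y * fy + x * fx + 2 * x * y * fxy)
        + (y * Δx / (2 * ε)) * (1 + y * Δt / (ε * Δx)) * fxx
        + (x * Δy / (2 * ε)) * (1 + x * Δt / (ε * Δy)) * fyy|
      ≤ (M * (2 + 2 * (L / ε)) + 1) * (Δt ^ 2 + Δx ^ 2 + Δy ^ 2) := by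
  have hK : 0 ≤ L / ε := by positivity
  have hxK : |x / ε| ≤ L / ε := by rw [abs_of_nonneg (by positivity)]; gcongr
  have hyK : |y / ε| ≤ L / ε := by rw [abs_of_nonneg (by positivity)]; gcongr
  have hftt : ftt = (y ^ 2 * fxx + x ^ 2 * fyy - y * fy - x * fx - 2 * x * y * fxy) / ε ^ 2 := by
    rw [eq_div_iff (by positivity)]
    linear_combination htt
  have hgt : gt = x / ε * gy - y / ε * gx := by linear_combination hs
  obtain ⟨R₁, hR₁⟩ : ∃ R, R = (F₀ - F₁) / -Δt - gt - -Δt / 2 * gtt := ⟨_, rfl⟩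
  obtain ⟨R₂, hR₂⟩ : ∃ R, R = (F₂ - F₁) / -Δx - gx - -Δx / 2 * gxx := ⟨_, rfl⟩
  obtain ⟨R₃, hR₃⟩ : ∃ R, R = (F₃ - F₁) / Δy - gy - Δy / 2 * gyy := ⟨_, rfl⟩
  obtain ⟨S₁, hS₁⟩ : ∃ S, S = gtt - ftt := ⟨_, rfl⟩
  obtain ⟨S₂, hS₂⟩ : ∃ S, S = gxx - fxx := ⟨_, rfl⟩
  obtain ⟨S₃, hS₃⟩ : ∃ S, S = gyy - fyy := ⟨_, rfl⟩
  rw [← hR₁] at Tt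
  rw [← hR₂] at Tx
  rw [← hR₃] at Ty
  rw [← hS₁] at Stt
  rw [← hS₂] at Sxx
  rw [← hS₃] at Syy
  have b₂ : |y / ε * R₂| ≤ L / ε * (M * Δx ^ 2) := by rw [abs_mul]; gcongr
  have b₃ : |x / ε * R₃| ≤ L / ε * (M * Δy ^ 2) := by rw [abs_mul]; gcongr
  have c₁ : |Δt / 2 * S₁| ≤ Δt / 2 * (M * Δt) := by
    rw [abs_mul, abs_of_pos (half_pos ht0)]; gcongr
  have c₂ : |y / ε * (Δx / 2 * S₂)| ≤ L / ε * (Δx / 2 * (M * Δt)) := by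
    rw [abs_mul, abs_mul, abs_of_pos (half_pos hx0)]; gcongr
  have c₃ : |x / ε * (Δy / 2 * S₃)| ≤ L / ε * (Δy / 2 * (M * Δt)) := by
    rw [abs_mul, abs_mul, abs_of_pos (half_pos hy0)]; gcongr
  calc _ = |R₁ + y / ε * R₂ - x / ε * R₃ - Δt / 2 * S₁ - y / ε * (Δx / 2 * S₂)
        - x / ε * (Δy / 2 * S₃)| := by
        congr 1
        rw [hR₁, hR₂, hR₃, hS₁, hS₂, hS₃, hftt, hgt]
        field_simp
        ring
    _ ≤ M * Δt ^ 2 + L / ε * (M * Δx ^ 2) + L / ε * (M * Δy ^ 2) + Δt / 2 * (M * Δt)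
        + L / ε * (Δx / 2 * (M * Δt)) + L / ε * (Δy / 2 * (M * Δt)) := by
        rw [abs_le] at Tt b₂ b₃ c₁ c₂ c₃ ⊢
        constructor <;> linarith [Tt.1, Tt.2, b₂.1, b₂.2, b₃.1, b₃.2, c₁.1, c₁.2, c₂.1, c₂.2,
          c₃.1, c₃.2]
    _ ≤ _ := by
        have hKM : 0 ≤ L / ε * M := by positivity
        have p₁ := mul_nonneg hKM (sq_nonneg (Δx - Δt))
        have p₂ := mul_nonneg hKM (sq_nonneg (Δy - Δt))
        have q₁ := mul_nonneg hKM (sq_nonneg Δt)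
        have q₂ := mul_nonneg hKM (sq_nonneg Δx)
        have q₃ := mul_nonneg hKM (sq_nonneg Δy)
        have r₁ := mul_nonneg hM0 (sq_nonneg Δt)
        have r₂ := mul_nonneg hM0 (sq_nonneg Δx)
        have r₃ := mul_nonneg hM0 (sq_nonneg Δy)
        linarith [sq_nonneg Δt, sq_nonneg Δx, sq_nonneg Δy]

/-- local truncation error of the fully implicit IMP upwind scheme for the second
Vlasov toy model `∂_t f + (y/ε) ∂_x f − (x/ε) ∂_y f = 0`, at points with `x, y ∈ [0,L]`:
`T = (Δt/(2ε²))(y ∂_y f + x ∂_x f + 2xy ∂²_{xy} f)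
   − (yΔx/(2ε))(1 + yΔt/(εΔx)) ∂²_{xx} f − (xΔy/(2ε))(1 + xΔt/(εΔy)) ∂²_{yy} f
   + O(Δt² + Δx² + Δy²)`, uniformly; the scheme is consistent and first order accurate,
with numerical diffusion proportional to `1/ε` in all directions. -/
theorem stmt_16 (ε L : ℝ) (hε : 0 < ε) (hL : 0 < L)
    (f : ℝ × ℝ × ℝ → ℝ) (hf : ContDiff ℝ 3 f)
    (hbd : ∃ M : ℝ, ∀ i : ℕ, i ≤ 3 → ∀ t x y : ℝ,
      x ∈ Set.Icc 0 L → y ∈ Set.Icc 0 L → ‖iteratedFDeriv ℝ i f (t, x, y)‖ ≤ M)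
    (hpde : ∀ t x y : ℝ,
      deriv (fun s : ℝ => f (s, x, y)) t + (y / ε) * deriv (fun u : ℝ => f (t, u, y)) x
        - (x / ε) * deriv (fun v : ℝ => f (t, x, v)) y = 0) :
    ∃ C > 0, ∀ Δt Δx Δy : ℝ,
      Δt ∈ Set.Ioc (0:ℝ) 1 → Δx ∈ Set.Ioc (0:ℝ) 1 → Δy ∈ Set.Ioc (0:ℝ) 1 →
      ∀ t : ℝ, ∀ x ∈ Set.Icc (0:ℝ) L, ∀ y ∈ Set.Icc (0:ℝ) L,
        |((f (t + Δt, x, y) - f (t, x, y)) / Δt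
            + (y / ε) * (f (t + Δt, x, y) - f (t + Δt, x - Δx, y)) / Δx
            - (x / ε) * (f (t + Δt, x, y + Δy) - f (t + Δt, x, y)) / Δy)
          - (Δt / (2 * ε ^ 2)) *
              (y * deriv (fun v : ℝ => f (t, x, v)) y
                + x * deriv (fun u : ℝ => f (t, u, y)) x
                + 2 * x * y * deriv (fun u : ℝ => deriv (fun v : ℝ => f (t, u, v)) y) x)
          + (y * Δx / (2 * ε)) * (1 + y * Δt / (ε * Δx))
              * iteratedDeriv 2 (fun u : ℝ => f (t, u, y)) x
          + (x * Δy / (2 * ε)) * (1 + x * Δt / (ε * Δy))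
              * iteratedDeriv 2 (fun v : ℝ => f (t, x, v)) y|
        ≤ C * (Δt ^ 2 + Δx ^ 2 + Δy ^ 2) := by
  have hf₂ : ContDiff ℝ 2 f := hf.of_le (by norm_num)
  have hf₁ : ContDiff ℝ 1 f := hf.of_le (by norm_num)
  have hD : ∀ v, ContDiff ℝ 2 (dirDeriv v f) := fun v => hf.dirDeriv (by norm_num) v
  have hD₁ : ∀ v, ContDiff ℝ 1 (dirDeriv v f) := fun v => (hD v).of_le (by norm_num)
  have hDD : ∀ v w, ContDiff ℝ 1 (dirDeriv v (dirDeriv w f)) := fun v w =>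
    (hD w).dirDeriv (by norm_num) v
  have dx : ∀ t x y, deriv (fun u : ℝ => f (t, u, y)) x = dirDeriv (0, 1, 0) f (t, x, y) :=
    fun t x y => (hasDerivAt_comp_dirDeriv hf₁ (hasDerivAt_slice₂ t x y)).deriv
  have dy : ∀ t x y, deriv (fun v : ℝ => f (t, x, v)) y = dirDeriv (0, 0, 1) f (t, x, y) :=
    fun t x y => (hasDerivAt_comp_dirDeriv hf₁ (hasDerivAt_slice₃ t x y)).deriv
  have dxy : ∀ t x y, deriv (fun u : ℝ => dirDeriv (0, 0, 1) f (t, u, y)) x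
      = dirDeriv (0, 1, 0) (dirDeriv (0, 0, 1) f) (t, x, y) :=
    fun t x y => (hasDerivAt_comp_dirDeriv (hD₁ _) (hasDerivAt_slice₂ t x y)).deriv
  have dxx : ∀ t x y, iteratedDeriv 2 (fun u : ℝ => f (t, u, y)) x
      = dirDeriv (0, 1, 0) (dirDeriv (0, 1, 0) f) (t, x, y) := fun t x y => by
    rw [iteratedDeriv_succ, iteratedDeriv_one, funext fun u => dx t u y]
    exact (hasDerivAt_comp_dirDeriv (hD₁ _) (hasDerivAt_slice₂ t x y)).deriv
  have dyy : ∀ t x y, iteratedDeriv 2 (fun v : ℝ => f (t, x, v)) y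
      = dirDeriv (0, 0, 1) (dirDeriv (0, 0, 1) f) (t, x, y) := fun t x y => by
    rw [iteratedDeriv_succ, iteratedDeriv_one, funext fun v => dy t x v]
    exact (hasDerivAt_comp_dirDeriv (hD₁ _) (hasDerivAt_slice₃ t x y)).deriv
  have pde : ∀ t x y : ℝ, dirDeriv (1, 0, 0) f (t, x, y)
      + y / ε * dirDeriv (0, 1, 0) f (t, x, y)
      - x / ε * dirDeriv (0, 0, 1) f (t, x, y) = 0 := fun t x y => by
    have h := hpde t x y
    rwa [dx, dy, (hasDerivAt_comp_dirDeriv hf₁ (hasDerivAt_slice₁ t x y)).deriv] at h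
  have hper := periodic_of_rotation_transport hε.ne' hf₁ pde
  have hbound : ∀ u v w, ∃ M, ∀ t, ∀ x ∈ Set.Icc (-1) (L + 1), ∀ y ∈ Set.Icc (-1) (L + 1),
      |dirDeriv u (dirDeriv v (dirDeriv w f)) (t, x, y)| ≤ M := fun u v w =>
    exists_abs_le_of_periodic_fst ((hDD v w).dirDeriv (m := 0) (by norm_num) u).continuous
      (by positivity) (dirDeriv_periodic (dirDeriv_periodic (dirDeriv_periodic hper w) v) u) _ _
  obtain ⟨M₁, hM₁⟩ := hbound (1, 0, 0) (1, 0, 0) (1, 0, 0)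
  obtain ⟨M₂, hM₂⟩ := hbound (0, 1, 0) (0, 1, 0) (0, 1, 0)
  obtain ⟨M₃, hM₃⟩ := hbound (0, 0, 1) (0, 0, 1) (0, 0, 1)
  obtain ⟨M₄, hM₄⟩ := hbound (1, 0, 0) (0, 1, 0) (0, 1, 0)
  obtain ⟨M₅, hM₅⟩ := hbound (1, 0, 0) (0, 0, 1) (0, 0, 1)
  obtain ⟨M, hM⟩ := ({0, M₁, M₂, M₃, M₄, M₅} : Finset ℝ).bddAbove
  have hM0 : 0 ≤ M := hM (by simp)
  have hM1 : M₁ ≤ M := hM (by simp)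
  have hM2 : M₂ ≤ M := hM (by simp)
  have hM3 : M₃ ≤ M := hM (by simp)
  have hM4 : M₄ ≤ M := hM (by simp)
  have hM5 : M₅ ≤ M := hM (by simp)
  refine ⟨M * (2 + 2 * (L / ε)) + 1, by positivity, ?_⟩
  rintro Δt Δx Δy ⟨ht0, ht1⟩ ⟨hx0, hx1⟩ ⟨hy0, hy1⟩ t x ⟨hxl, hxu⟩ y ⟨hyl, hyu⟩
  have hxI : x ∈ Set.Icc (-1) (L + 1) := ⟨by linarith, by linarith⟩
  have hyI : y ∈ Set.Icc (-1) (L + 1) := ⟨by linarith, by linarith⟩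
  have Tt := abs_slope_sub_taylor_le (a := t + Δt) (b := t)
    (fun s => hasDerivAt_comp_dirDeriv hf₁ (hasDerivAt_slice₁ s x y))
    (fun s => hasDerivAt_comp_dirDeriv (hD₁ _) (hasDerivAt_slice₁ s x y))
    (fun s => hasDerivAt_comp_dirDeriv (hDD _ _) (hasDerivAt_slice₁ s x y))
    (by linarith) (fun s _ => (hM₁ s x hxI y hyI).trans hM1)
  have Tx := abs_slope_sub_taylor_le (a := x) (b := x - Δx)
    (fun u => hasDerivAt_comp_dirDeriv hf₁ (hasDerivAt_slice₂ (t + Δt) u y))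
    (fun u => hasDerivAt_comp_dirDeriv (hD₁ _) (hasDerivAt_slice₂ (t + Δt) u y))
    (fun u => hasDerivAt_comp_dirDeriv (hDD _ _) (hasDerivAt_slice₂ (t + Δt) u y))
    (by linarith) (fun u hu => (hM₂ (t + Δt) u (by
      rw [Set.uIcc_of_ge (by linarith)] at hu
      exact ⟨by linarith [hu.1], by linarith [hu.2]⟩) y hyI).trans hM2)
  have Ty := abs_slope_sub_taylor_le (a := y) (b := y + Δy)
    (fun v => hasDerivAt_comp_dirDeriv hf₁ (hasDerivAt_slice₃ (t + Δt) x v))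
    (fun v => hasDerivAt_comp_dirDeriv (hD₁ _) (hasDerivAt_slice₃ (t + Δt) x v))
    (fun v => hasDerivAt_comp_dirDeriv (hDD _ _) (hasDerivAt_slice₃ (t + Δt) x v))
    (by linarith) (fun v hv => (hM₃ (t + Δt) x hxI v (by
      rw [Set.uIcc_of_le (by linarith)] at hv
      exact ⟨by linarith [hv.1], by linarith [hv.2]⟩)).trans hM3)
  have Stt := abs_sub_le_of_hasDerivAt_uIcc (a := t) (b := t + Δt)
    (fun s => hasDerivAt_comp_dirDeriv (hDD (1, 0, 0) (1, 0, 0)) (hasDerivAt_slice₁ s x y))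
    (fun s _ => (hM₁ s x hxI y hyI).trans hM1) _ Set.right_mem_uIcc
  have Sxx := abs_sub_le_of_hasDerivAt_uIcc (a := t) (b := t + Δt)
    (fun s => hasDerivAt_comp_dirDeriv (hDD (0, 1, 0) (0, 1, 0)) (hasDerivAt_slice₁ s x y))
    (fun s _ => (hM₄ s x hxI y hyI).trans hM4) _ Set.right_mem_uIcc
  have Syy := abs_sub_le_of_hasDerivAt_uIcc (a := t) (b := t + Δt)
    (fun s => hasDerivAt_comp_dirDeriv (hDD (0, 0, 1) (0, 0, 1)) (hasDerivAt_slice₁ s x y))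
    (fun s _ => (hM₅ s x hxI y hyI).trans hM5) _ Set.right_mem_uIcc
  have hs := pde (t + Δt) x y
  have htt := rotation_transport_second_time_deriv hε.ne' hf₂ pde t x y
  simp only [dy, dx, dxy, dxx, dyy]
  rw [show t - (t + Δt) = -Δt by ring, neg_sq] at Tt
  rw [show x - Δx - x = -Δx by ring, neg_sq] at Tx
  rw [show y + Δy - y = Δy by ring] at Ty
  rw [show t + Δt - t = Δt by ring, abs_of_pos ht0] at Stt Sxx Syy
  exact imp_truncation_error_le hε hL hM0 ht0 hx0 hy0 hxl hxu hyl hyu Tt Tx Ty Stt Sxx Syy hs htt
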